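/- (Proposition 2, combined form.) Let d ∈ ℕ, z ∈ EuclideanSpace ℝ (Fin d), weight vectors w_A, w_B ∈ EuclideanSpace ℝ (Fin d), biases b_A, b_B ∈ ℝ, and set w := w_A − w_B, b := b_A − b_B, m := ⟪w, z⟫ + b. Let μ be a probability measure on ℝ whose cumulative distribution function F is continuous and strictly increasing on ℝ, and define p_A := μ({t : m + t > 0}). Then 1 − p_A lies in the range of F, and the two-class softmax probability of class A satisfies exp(⟪w_A, z⟫ + b_A) / (exp(⟪w_A, z⟫ + b_A) + exp(⟪w_B, z⟫ + b_B)) = 1 / (1 + exp(u)) for the unique u ∈ ℝ with F(u) = 1 − p_A, i.e., it equals 1 / (1 + exp(F⁻¹(1 − p_A))). -/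

import Mathlib

open MeasureTheory RealInnerProductSpace

/-- **Proposition 2 (combined form).**
With `w = w_A - w_B`, `b = b_A - b_B`, margin `m = ⟪w, z⟫ + b`, a probability measure
`μ` on `ℝ` whose CDF `F` is continuous and strictly increasing, and
`p_A = μ {t | m + t > 0}`: `1 - p_A` lies in the range of `F`, and the two-class
softmax probability of class `A` equals `1 / (1 + exp u)` for the unique `u` with
`F u = 1 - p_A`, i.e. it equals `1 / (1 + exp (F⁻¹(1 - p_A)))`. -/
theorem softmax_eq_sigmoid_of_general_noise_quantile
    (d : ℕ) (z wA wB : EuclideanSpace ℝ (Fin d)) (bA bB : ℝ)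
    (w : EuclideanSpace ℝ (Fin d)) (hwdef : w = wA - wB)
    (b : ℝ) (hb : b = bA - bB)
    (m : ℝ) (hm : m = ⟪w, z⟫ + b)
    (μ : Measure ℝ) [IsProbabilityMeasure μ]
    (F : ℝ → ℝ) (hF : ∀ x : ℝ, F x = (μ (Set.Iic x)).toReal)
    (hFcont : Continuous F) (hFmono : StrictMono F)
    (pA : ℝ) (hpA : pA = (μ {t : ℝ | m + t > 0}).toReal) :
    (1 - pA) ∈ Set.range F ∧
      ∀ u : ℝ, F u = 1 - pA →
        Real.exp (⟪wA, z⟫ + bA) /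
            (Real.exp (⟪wA, z⟫ + bA) + Real.exp (⟪wB, z⟫ + bB)) =
          1 / (1 + Real.exp u) := by
  have hset : {t : ℝ | m + t > 0} = (Set.Iic (-m))ᶜ := by
    ext t
    simp only [Set.mem_ofPred_eq, Set.mem_compl_iff, Set.mem_Iic, not_le]
    constructor <;> intro h <;> linarith
  have hFm : F (-m) = 1 - pA := by
    have hcompl := probReal_compl_eq_one_sub (μ := μ) (measurableSet_Iic (a := -m))
    simp only [measureReal_def] at hcompl
    rw [hF, hpA, hset, hcompl]
    ring
  refine ⟨⟨-m, hFm⟩, fun u hu => ?_⟩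
  obtain rfl : u = -m := hFmono.injective (hu.trans hFm.symm)
  have hlogit : ⟪wB, z⟫ + bB = (⟪wA, z⟫ + bA) + -m := by
    rw [hm, hwdef, hb, inner_sub_left]
    ring
  rw [hlogit, Real.exp_add (⟪wA, z⟫ + bA) (-m)]
  field_simp
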